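/- arXiv:1503.02606 — 3 statements merged into one kernel-verified Lean document; each statement's English description precedes it below -/
import Mathlib

section
/- Let P be a nonzero monomial Rota-Baxter operator of weight 0 on k[x] given by P(x^n) = β(n)·x^{θ(n)}, and let d be the greatest common divisor of the set θ(S_β) = {θ(n) : β(n) ≠ 0}. Then S_β is a disjoint union of full residue classes modulo d: there exist an integer k ≥ 1 and integers 0 ≤ s_1 < s_2 < ⋯ < s_k ≤ d−1 such that S_β = (s_1 + dℕ) ⊎ (s_2 + dℕ) ⊎ ⋯ ⊎ (s_k + dℕ). Equivalently, for all m, n ∈ ℕ with m ≡ n (mod d), one has β(m) ≠ 0 if and only if β(n) ≠ 0. -/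
open Polynomial

/-- The Rota-Baxter identity of weight zero, evaluated on a pair of monomials. -/
lemma rotaBaxter_monomial_identity {R : Type*} [CommRing R] {β : ℕ → R} {θ : ℕ → ℕ}
    {P : Polynomial R →ₗ[R] Polynomial R}
    (hP : ∀ n : ℕ, P (X ^ n) = C (β n) * X ^ (θ n))
    (hRB : ∀ f g : Polynomial R, P f * P g = P (f * P g) + P (P f * g)) (m n : ℕ) :
    C (β m * β n) * X ^ (θ m + θ n) =
      C (β n * β (m + θ n)) * X ^ θ (m + θ n) + C (β m * β (n + θ m)) * X ^ θ (n + θ m) := by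
  have hmul : ∀ (a : R) (k : ℕ), P (C a * X ^ k) = C (a * β k) * X ^ θ k := by
    intro a k
    rw [← smul_eq_C_mul, map_smul, hP, smul_eq_C_mul, C_mul, mul_assoc]
  have h := hRB (X ^ m) (X ^ n)
  have h₁ : (X : R[X]) ^ m * (C (β n) * X ^ θ n) = C (β n) * X ^ (m + θ n) := by ring
  have h₂ : C (β m) * X ^ θ m * (X : R[X]) ^ n = C (β m) * X ^ (n + θ m) := by ring
  rw [hP, hP, h₁, h₂, hmul, hmul] at h
  rw [← h, C_mul]
  ring

/-- The complement of the support is stable under translation by `θ n` for `n` in the support. -/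
lemma rotaBaxter_coeff_add_eq_zero {R : Type*} [CommRing R] [IsDomain R] {β : ℕ → R} {θ : ℕ → ℕ}
    {P : Polynomial R →ₗ[R] Polynomial R}
    (hP : ∀ n : ℕ, P (X ^ n) = C (β n) * X ^ (θ n))
    (hRB : ∀ f g : Polynomial R, P f * P g = P (f * P g) + P (P f * g)) {m n : ℕ}
    (hm : β m = 0) (hn : β n ≠ 0) : β (m + θ n) = 0 := by
  have h := rotaBaxter_monomial_identity hP hRB m n
  simpa [hm, hn] using h.symm

/-- The support is stable under `n ↦ n + θ n`. -/
lemma rotaBaxter_coeff_add_self_ne_zero {R : Type*} [CommRing R] [IsDomain R] {β : ℕ → R}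
    {θ : ℕ → ℕ} {P : Polynomial R →ₗ[R] Polynomial R}
    (hP : ∀ n : ℕ, P (X ^ n) = C (β n) * X ^ (θ n))
    (hRB : ∀ f g : Polynomial R, P f * P g = P (f * P g) + P (P f * g)) {n : ℕ}
    (hn : β n ≠ 0) : β (n + θ n) ≠ 0 := by
  intro h0
  have h := rotaBaxter_monomial_identity hP hRB n n
  simp [h0, hn] at h

/-- The exponent map is positive on the support. -/
lemma rotaBaxter_exponent_pos {R : Type*} [CommRing R] [IsDomain R] {β : ℕ → R}
    {θ : ℕ → ℕ} {P : Polynomial R →ₗ[R] Polynomial R}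
    (hP : ∀ n : ℕ, P (X ^ n) = C (β n) * X ^ (θ n))
    (hRB : ∀ f g : Polynomial R, P f * P g = P (f * P g) + P (P f * g)) {n : ℕ}
    (hn : β n ≠ 0) : 0 < θ n := by
  by_contra h0
  have h := rotaBaxter_monomial_identity hP hRB n n
  simp [show θ n = 0 by omega, hn] at h

/-- Every residue class meeting the support contains arbitrarily large elements of it. -/
lemma rotaBaxter_exists_ge_support {R : Type*} [CommRing R] [IsDomain R] {β : ℕ → R}
    {θ : ℕ → ℕ} {P : Polynomial R →ₗ[R] Polynomial R}
    (hP : ∀ n : ℕ, P (X ^ n) = C (β n) * X ^ (θ n))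
    (hRB : ∀ f g : Polynomial R, P f * P g = P (f * P g) + P (P f * g)) {d : ℕ}
    (hd : ∀ n : ℕ, β n ≠ 0 → d ∣ θ n) {n : ℕ} (hn : β n ≠ 0) (N : ℕ) :
    ∃ k, N ≤ k ∧ β k ≠ 0 ∧ k ≡ n [MOD d] := by
  induction N with
  | zero => exact ⟨n, Nat.zero_le _, hn, rfl⟩
  | succ N ih =>
    obtain ⟨k, hNk, hk, hkn⟩ := ih
    have hpos := rotaBaxter_exponent_pos hP hRB hk
    refine ⟨k + θ k, by omega, rotaBaxter_coeff_add_self_ne_zero hP hRB hk, ?_⟩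
    simpa using hkn.add ((Nat.modEq_zero_iff_dvd).2 (hd k hk))

/-- Proposition 2.6: for a nonzero monomial Rota-Baxter operator of weight zero,
with `d = gcd(θ(S_β))`, the support `S_β` is a disjoint union of full residue
classes modulo `d`: for all `m ≡ n (mod d)`, `β m ≠ 0 ↔ β n ≠ 0`. -/
theorem monomial_rota_baxter_weight_zero_support_residue_classes
    {R : Type*} [CommRing R] [IsDomain R] [Algebra ℚ R]
    (β : ℕ → R) (θ : ℕ → ℕ) (hconv : ∀ n, β n = 0 → θ n = 0)
    (P : Polynomial R →ₗ[R] Polynomial R)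
    (hP : ∀ n : ℕ, P (X ^ n) = C (β n) * X ^ (θ n))
    (hRB : ∀ f g : Polynomial R, P f * P g = P (f * P g) + P (P f * g))
    (hne : ∃ n : ℕ, β n ≠ 0)
    (d : ℕ)
    (hd_dvd : ∀ n : ℕ, β n ≠ 0 → d ∣ θ n)
    (hd_gcd : ∀ e : ℕ, (∀ n : ℕ, β n ≠ 0 → e ∣ θ n) → e ∣ d) :
    ∀ m n : ℕ, m % d = n % d → (β m ≠ 0 ↔ β n ≠ 0) := by
  suffices key : ∀ m n : ℕ, m % d = n % d → β m ≠ 0 → β n ≠ 0 from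
    fun m n h => ⟨key m n h, key n m h.symm⟩
  intro m n hmn hm hn
  let T : Set ℕ := θ '' {k | β k ≠ 0}
  have hclosed : ∀ a ∈ AddSubmonoid.closure T, ∀ k, β k = 0 → β (k + a) = 0 := by
    intro a ha
    induction ha using AddSubmonoid.closure_induction with
    | mem x hx =>
      obtain ⟨j, hj, rfl⟩ := hx
      exact fun k hk => rotaBaxter_coeff_add_eq_zero hP hRB hk hj
    | zero => exact fun k hk => hk
    | add x y _ _ ihx ihy =>
      intro k hk
      rw [← add_assoc]
      exact ihy _ (ihx _ hk)
  obtain ⟨N, hN⟩ := Nat.exists_mem_closure_of_ge T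
  obtain ⟨k, hNk, hk, hkm⟩ := rotaBaxter_exists_ge_support hP hRB hd_dvd hm (n + N)
  have hdvd : d ∣ k - n := (Nat.modEq_iff_dvd' (by omega)).1 (hkm.trans hmn).symm
  have hgcd : Nat.setGcd T ∣ d :=
    hd_gcd _ fun j hj => Nat.setGcd_dvd_of_mem ⟨j, hj, rfl⟩
  have h := hclosed (k - n) (hN _ (by omega) (hgcd.trans hdvd)) n hn
  rw [show n + (k - n) = k by omega] at h
  exact hk h
end

section
/- Let P be a monomial linear operator on k[x] given by P(x^n) = β(n)·x^{θ(n)} for all n ∈ ℕ. Then P is a Rota-Baxter operator of weight 0 if and only if there exist a positive integer d, nonnegative integers c_0, c_1, …, c_{d−1}, and elements b_0, b_1, …, b_{d−1} ∈ k such that: (1) for each i ∈ {0, …, d−1}, b_i = 0 if and only if c_i = 0; and (2) for every n ∈ ℕ with remainder n̄ ∈ {0, …, d−1} of n modulo d, one has θ(n) = 0 and β(n) = 0 when b_{n̄} = 0, while θ(n) = c_{n̄}·d + n − n̄ and β(n) = (c_{n̄}·d / (c_{n̄}·d + n − n̄))·b_{n̄} when b_{n̄} ≠ 0 (the rational coefficient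 acting on k via ℚ ⊆ k). -/
open Polynomial

/-- The Rota-Baxter identity of weight zero, for the monomial operator with data `β`, `θ`,
evaluated on a pair of powers of `X`. -/
def MonomialRotaBaxter {R : Type*} [CommRing R] (β : ℕ → R) (θ : ℕ → ℕ) : Prop :=
  ∀ m n : ℕ, monomial (θ m + θ n) (β m * β n) =
    monomial (θ (m + θ n)) (β n * β (m + θ n)) + monomial (θ (n + θ m)) (β m * β (n + θ m))

theorem rotaBaxter_iff_monomialRotaBaxter {R : Type*} [CommRing R] {β : ℕ → R} {θ : ℕ → ℕ}
    {P : R[X] →ₗ[R] R[X]} (hP : ∀ n : ℕ, P (X ^ n) = C (β n) * X ^ (θ n)) :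
    (∀ f g : R[X], P f * P g = P (f * P g) + P (P f * g)) ↔ MonomialRotaBaxter β θ := by
  have hP' : ∀ (n : ℕ) (a : R), P (monomial n a) = monomial (θ n) (a * β n) := by
    intro n a
    rw [← mul_one a, ← smul_eq_mul, ← smul_monomial, map_smul, monomial_one_right_eq_X_pow, hP,
      C_mul_X_pow_eq_monomial, smul_monomial]
    simp
  constructor
  · intro h m n
    have := h (monomial m 1) (monomial n 1)
    simpa [hP', monomial_mul_monomial, add_comm (θ m) n] using this
  · intro h f g
    induction f using Polynomial.induction_on' with
    | add p q hp hq => simp only [map_add, add_mul, hp, hq]; abel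
    | monomial m a =>
      induction g using Polynomial.induction_on' with
      | add p q hp hq => simp only [map_add, mul_add, hp, hq]; abel
      | monomial n b =>
        have := congrArg (fun p => (a * b) • p) (h m n)
        simp only [smul_add, smul_monomial, smul_eq_mul] at this
        simp only [hP', monomial_mul_monomial, add_comm (θ m) n]
        convert this using 2 <;> ring_nf

namespace MonomialRotaBaxter

variable {R : Type*} [CommRing R] [IsDomain R] {β : ℕ → R} {θ : ℕ → ℕ}

theorem coeff_eq_zero_add (h : MonomialRotaBaxter β θ)
    {m n : ℕ} (hm : β m = 0) (hn : β n ≠ 0) : β (m + θ n) = 0 := by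
  have := h m n
  simpa [hm, hn] using this.symm

theorem coeff_eq_zero_add_mul (h : MonomialRotaBaxter β θ)
    {m n : ℕ} (hm : β m = 0) (hn : β n ≠ 0) (k : ℕ) : β (m + k * θ n) = 0 := by
  induction k with
  | zero => simpa using hm
  | succ k ih =>
    have := h.coeff_eq_zero_add ih hn
    rwa [show m + (k + 1) * θ n = m + k * θ n + θ n by ring]

theorem progression [CharZero R] (h : MonomialRotaBaxter β θ) {n : ℕ} (hn : β n ≠ 0) (j : ℕ) :
    θ (n + j * θ n) = (j + 1) * θ n ∧ (j + 1 : R) * β (n + j * θ n) = β n := by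
  induction j with
  | zero => simp
  | succ j ih =>
    obtain ⟨hθ, hβ⟩ := ih
    have hj : β (n + j * θ n) ≠ 0 := by
      intro h0
      rw [h0, mul_zero] at hβ
      exact hn hβ.symm
    have key := h n (n + j * θ n)
    rw [hθ, show n + j * θ n + θ n = n + (j + 1) * θ n by ring, ← map_add, ← add_mul] at key
    have hne : β n * β (n + j * θ n) ≠ 0 := mul_ne_zero hn hj
    have hdeg := congrArg natDegree key
    have hlead := congrArg leadingCoeff key
    rw [leadingCoeff_monomial, leadingCoeff_monomial] at hlead
    rw [natDegree_monomial_eq _ hne, natDegree_monomial_eq _ (hlead ▸ hne)] at hdeg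
    refine ⟨by rw [← hdeg]; ring, mul_left_cancel₀ hj ?_⟩
    push_cast
    rw [← hβ] at hlead ⊢
    linear_combination -hlead

theorem exponent_pos [CharZero R] (h : MonomialRotaBaxter β θ) {n : ℕ} (hn : β n ≠ 0) :
    0 < θ n := by
  refine Nat.pos_of_ne_zero fun h0 => hn ?_
  have := (h.progression hn 1).2
  simp only [h0, mul_zero, add_zero] at this
  push_cast at this
  linear_combination this

theorem coeff_ne_zero_add [CharZero R] (h : MonomialRotaBaxter β θ)
    {m n : ℕ} (hm : β m ≠ 0) (hn : β n ≠ 0) :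
    β (m + θ n) ≠ 0 := by
  intro h0
  have hzero := h.coeff_eq_zero_add_mul h0 hn (θ m - 1)
  have hprog := (h.progression hm (θ n)).2
  have hpos := h.exponent_pos hm
  obtain ⟨t, ht⟩ : ∃ t, θ m = t + 1 := ⟨θ m - 1, by lia⟩
  rw [ht] at hzero hprog
  rw [show m + θ n * (t + 1) = m + θ n + (t + 1 - 1) * θ n by simp; ring, hzero, mul_zero] at hprog
  exact hm hprog.symm

theorem exponent_add [CharZero R] (h : MonomialRotaBaxter β θ)
    {m n : ℕ} (hm : β m ≠ 0) (hn : β n ≠ 0) :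
    θ (m + θ n) = θ m + θ n := by
  have h1 := mul_ne_zero hn (h.coeff_ne_zero_add hm hn)
  have h2 := mul_ne_zero hm (h.coeff_ne_zero_add hn hm)
  by_contra hne
  have e1 := congrArg (fun p => coeff p (θ (m + θ n))) (h m n)
  have e2 := congrArg (fun p => coeff p (θ m + θ n)) (h m n)
  have h3 := mul_ne_zero hm hn
  simp only [coeff_add, coeff_monomial] at e1 e2
  grind

/-- Data with `θ (n) - θ (m) = n - m` have equal products `θ * β`. -/
theorem exponent_mul_coeff_eq [CharZero R] (h : MonomialRotaBaxter β θ) {m n : ℕ}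
    (hm : β m ≠ 0) (hn : β n ≠ 0) (hmn : θ n + m = θ m + n) :
    (θ n : R) * β n = θ m * β m := by
  obtain ⟨s, hs⟩ : ∃ s, θ m = s + 1 := ⟨θ m - 1, by have := h.exponent_pos hm; lia⟩
  obtain ⟨t, ht⟩ : ∃ t, θ n = t + 1 := ⟨θ n - 1, by have := h.exponent_pos hn; lia⟩
  have h1 := (h.progression hm t).2
  have h2 := (h.progression hn s).2
  have he : m + t * θ m = n + s * θ n := by
    rw [hs, ht] at hmn ⊢
    linarith
  rw [he] at h1
  rw [← h1, ← h2, hs, ht]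
  push_cast
  ring

end MonomialRotaBaxter

/-- Translation by `p` preserves the support of `β`, and `θ` is translation equivariant there. -/
def IsShift {R : Type*} [CommRing R] (β : ℕ → R) (θ : ℕ → ℕ) (p : ℕ) : Prop :=
  ∀ n, (β (n + p) = 0 ↔ β n = 0) ∧ (β n ≠ 0 → θ (n + p) = θ n + p)

namespace IsShift

variable {R : Type*} [CommRing R] {β : ℕ → R} {θ : ℕ → ℕ} {p q : ℕ}

theorem of_add (hq : IsShift β θ q) (hpq : IsShift β θ (p + q)) : IsShift β θ p := by
  intro n
  have h1 := hq (n + p)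
  have h2 := hpq n
  rw [← add_assoc] at h2
  refine ⟨h1.1.symm.trans h2.1, fun hn => ?_⟩
  have h3 := h1.2 (fun h0 => hn (h2.1.1 (h1.1.2 h0)))
  have h4 := h2.2 hn
  lia

theorem mul (hp : IsShift β θ p) (k : ℕ) : IsShift β θ (k * p) := by
  induction k with
  | zero => intro n; simp
  | succ k ih =>
    intro n
    have h1 := ih n
    have h2 := hp (n + k * p)
    rw [show n + (k + 1) * p = n + k * p + p by ring]
    refine ⟨h2.1.trans h1.1, fun hn => ?_⟩
    rw [h2.2 (fun h0 => hn (h1.1.1 h0)), h1.2 hn]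
    ring

theorem mod (hp : IsShift β θ p) (hq : IsShift β θ q) : IsShift β θ (q % p) := by
  refine (hp.mul (q / p)).of_add ?_
  rwa [mul_comm, Nat.mod_add_div]

end IsShift

theorem MonomialRotaBaxter.isShift_exponent {R : Type*} [CommRing R] [IsDomain R] [CharZero R]
    {β : ℕ → R} {θ : ℕ → ℕ} (h : MonomialRotaBaxter β θ)
    {n : ℕ} (hn : β n ≠ 0) : IsShift β θ (θ n) := fun _ =>
  ⟨⟨fun h0 => by_contra fun hm => h.coeff_ne_zero_add hm hn h0,
    fun hm => h.coeff_eq_zero_add hm hn⟩, fun hm => h.exponent_add hm hn⟩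

/-- There is a positive shift dividing every exponent that occurs. -/
theorem MonomialRotaBaxter.exists_isShift_dvd {R : Type*} [CommRing R] [IsDomain R] [CharZero R]
    {β : ℕ → R} {θ : ℕ → ℕ} (h : MonomialRotaBaxter β θ) (hconv : ∀ n, β n = 0 → θ n = 0) :
    ∃ d, 0 < d ∧ IsShift β θ d ∧ ∀ n, d ∣ θ n := by
  classical
  have hex : ∃ d, 0 < d ∧ IsShift β θ d := by
    by_cases hS : ∃ n, β n ≠ 0
    · obtain ⟨n, hn⟩ := hS
      exact ⟨θ n, h.exponent_pos hn, h.isShift_exponent hn⟩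
    · push Not at hS
      exact ⟨1, one_pos, fun n => by simp [hS]⟩
  obtain ⟨hpos, hd⟩ := Nat.find_spec hex
  refine ⟨Nat.find hex, hpos, hd, fun n => ?_⟩
  by_cases hn : β n = 0
  · simp [hconv n hn]
  · by_contra hdvd
    exact Nat.find_min hex (Nat.mod_lt _ hpos)
      ⟨Nat.pos_of_ne_zero fun h0 => hdvd (Nat.dvd_of_mod_eq_zero h0),
        hd.mod (h.isShift_exponent hn)⟩

theorem eq_div_smul_iff_mul_eq {R : Type*} [CommRing R] [IsDomain R] [Algebra ℚ R] {p q : ℕ}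
    (hq : q ≠ 0) (x y : R) : x = ((p : ℚ) / (q : ℚ)) • y ↔ (q : R) * x = p * y := by
  have hq' : (q : ℚ) ≠ 0 := Nat.cast_ne_zero.2 hq
  have hcast : ∀ (k : ℕ) (z : R), (k : R) * z = (k : ℚ) • z := by
    intro k z
    rw [Algebra.smul_def, map_natCast]
  rw [hcast, hcast, div_eq_inv_mul, mul_smul, eq_inv_smul_iff₀ hq']

/-- Data that are periodic up to the rational factor dictated by `θ` satisfy the identity. -/
theorem monomialRotaBaxter_of_isShift {R : Type*} [CommRing R] [IsDomain R] [CharZero R]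
    {β : ℕ → R} {θ : ℕ → ℕ} (hpos : ∀ n, β n ≠ 0 → 0 < θ n)
    (hshift : ∀ n, β n ≠ 0 → IsShift β θ (θ n))
    (hmul : ∀ m n, β m ≠ 0 → β n ≠ 0 → (θ (m + θ n) : R) * β (m + θ n) = θ m * β m) :
    MonomialRotaBaxter β θ := by
  intro m n
  by_cases hm : β m = 0 <;> by_cases hn : β n = 0
  · simp [hm, hn]
  · simp [hm, ((hshift n hn) m).1.2 hm]
  · simp [hn, ((hshift m hm) n).1.2 hn]
  · have e1 := ((hshift n hn) m).2 hm
    have e2 := ((hshift m hm) n).2 hn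
    have h1 := hmul m n hm hn
    have h2 := hmul n m hn hm
    have hne : ((θ m + θ n : ℕ) : R) ≠ 0 := Nat.cast_ne_zero.2 (by have := hpos m hm; lia)
    rw [e1] at h1
    rw [e2, add_comm (θ n)] at h2
    rw [e1, e2, add_comm (θ n) (θ m), ← map_add]
    congr 1
    refine mul_left_cancel₀ hne ?_
    push_cast at h1 h2 ⊢
    linear_combination -(β n) * h1 - β m * h2

/-- Theorem 2.9: classification of monomial Rota-Baxter operators of weight
zero on `R[x]`. -/
theorem monomial_rota_baxter_weight_zero_classification
    {R : Type*} [CommRing R] [IsDomain R] [Algebra ℚ R]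
    (β : ℕ → R) (θ : ℕ → ℕ) (hconv : ∀ n, β n = 0 → θ n = 0)
    (P : Polynomial R →ₗ[R] Polynomial R)
    (hP : ∀ n : ℕ, P (X ^ n) = C (β n) * X ^ (θ n)) :
    (∀ f g : Polynomial R, P f * P g = P (f * P g) + P (P f * g)) ↔
      ∃ (d : ℕ), 0 < d ∧ ∃ (c : ℕ → ℕ) (b : ℕ → R),
        (∀ i : ℕ, i < d → (b i = 0 ↔ c i = 0)) ∧
        (∀ n : ℕ,
          (b (n % d) = 0 → θ n = 0 ∧ β n = 0) ∧
          (b (n % d) ≠ 0 →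
            θ n = c (n % d) * d + (n - n % d) ∧
            β n = (((c (n % d) * d : ℕ) : ℚ) /
                    ((c (n % d) * d + (n - n % d) : ℕ) : ℚ)) • b (n % d))) := by
  have : CharZero R := algebraRat.charZero R
  rw [rotaBaxter_iff_monomialRotaBaxter hP]
  constructor
  · intro h
    obtain ⟨d, hd, hshift, hdvd⟩ := h.exists_isShift_dvd hconv
    refine ⟨d, hd, fun i => θ i / d, β, fun i _ => ⟨fun hi => by simp [hconv i hi], ?_⟩, ?_⟩
    · intro hi
      by_contra hβ
      exact (Nat.div_pos (Nat.le_of_dvd (h.exponent_pos hβ) (hdvd i)) hd).ne' hi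
    · intro n
      have hn : n % d + n / d * d = n := Nat.mod_add_div' n d
      have hs := hshift.mul (n / d) (n % d)
      rw [hn] at hs
      refine ⟨fun h0 => ⟨hconv n (hs.1.2 h0), hs.1.2 h0⟩, fun h0 => ?_⟩
      have hn0 : β n ≠ 0 := fun h1 => h0 (hs.1.1 h1)
      have hθ : θ n = θ (n % d) + (n - n % d) := by
        rw [hs.2 h0]
        lia
      simp only [Nat.div_mul_cancel (hdvd (n % d))]
      rw [← hθ]
      refine ⟨rfl, ?_⟩
      rw [eq_div_smul_iff_mul_eq (h.exponent_pos hn0).ne']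
      refine h.exponent_mul_coeff_eq h0 hn0 ?_
      have := Nat.mod_le n d
      lia
  · rintro ⟨d, hd, c, b, hbc, hform⟩
    have hb : ∀ n, β n ≠ 0 → b (n % d) ≠ 0 := fun n hn h0 => hn ((hform n).1 h0).2
    have hbpos : ∀ n, b (n % d) ≠ 0 → 0 < θ n := by
      intro n hn
      rw [((hform n).2 hn).1]
      have : 0 < c (n % d) :=
        Nat.pos_of_ne_zero fun h0 => hn ((hbc _ (Nat.mod_lt n hd)).2 h0)
      positivity
    have hbmul : ∀ n, b (n % d) ≠ 0 → (θ n : R) * β n = (c (n % d) * d : ℕ) * b (n % d) := by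
      intro n hn
      have hpos := hbpos n hn
      obtain ⟨hθ, hβ⟩ := (hform n).2 hn
      rw [← hθ] at hβ
      exact (eq_div_smul_iff_mul_eq hpos.ne' _ _).1 hβ
    have hβb : ∀ n, β n = 0 ↔ b (n % d) = 0 := by
      refine fun n => ⟨fun h0 => by_contra fun hn => ?_, fun h0 => ((hform n).1 h0).2⟩
      exact (hbpos n hn).ne' (hconv n h0)
    have hmod : ∀ m n, β n ≠ 0 → (m + θ n) % d = m % d := by
      intro m n hn
      have hdvd : d ∣ θ n := by
        rw [((hform n).2 (hb n hn)).1]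
        exact dvd_add (dvd_mul_left _ _) (Nat.dvd_sub_mod n)
      rw [Nat.add_mod, Nat.mod_eq_zero_of_dvd hdvd, add_zero, Nat.mod_mod]
    refine monomialRotaBaxter_of_isShift (fun n hn => hbpos n (hb n hn)) ?_ ?_
    · intro n hn m
      refine ⟨by rw [hβb, hβb, hmod m n hn], fun hm => ?_⟩
      have h1 := ((hform m).2 (hb m hm)).1
      have h2 := ((hform (m + θ n)).2 (by rw [hmod m n hn]; exact hb m hm)).1
      rw [hmod m n hn] at h2
      have := Nat.mod_le m d
      lia
    · intro m n hm hn
      rw [hbmul m (hb m hm), hbmul (m + θ n) (by rw [hmod m n hn]; exact hb m hm), hmod m n hn]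
end

section
/- Let λ ∈ k with λ ≠ 0, and let P be a nonzero monomial Rota-Baxter operator of weight λ on k[x] given by P(x^n) = β(n)·x^{θ(n)}, and assume S_θ = ℕ* (i.e. θ(n) ≠ 0 for every n ≥ 1). Then for all positive integers m, n, if θ(m) = θ(n) then θ(m + n) = 2·θ(m). -/
open Polynomial

/-- The Rota-Baxter identity for a monomial operator, evaluated at `X ^ m` and `X ^ n` and read off
coefficient by coefficient. -/
theorem monomial_rota_baxter_coeff {R : Type*} [CommRing R]
    (lam : R) (β : ℕ → R) (θ : ℕ → ℕ) (P : Polynomial R →ₗ[R] Polynomial R)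
    (hP : ∀ n : ℕ, P (X ^ n) = C (β n) * X ^ (θ n))
    (hRB : ∀ f g : Polynomial R,
      P f * P g = P (f * P g) + P (P f * g) + lam • P (f * g))
    (m n d : ℕ) :
    (if d = θ m + θ n then β m * β n else 0) =
      (if d = θ (m + θ n) then β n * β (m + θ n) else 0) +
      (if d = θ (θ m + n) then β m * β (θ m + n) else 0) +
      (if d = θ (m + n) then lam * β (m + n) else 0) := by
  have hmul : P (X ^ m) * P (X ^ n) = C (β m * β n) * X ^ (θ m + θ n) := by
    rw [hP, hP, C_mul]
    ring
  have hright : P (X ^ m * P (X ^ n)) = C (β n * β (m + θ n)) * X ^ θ (m + θ n) := by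
    rw [hP n, mul_left_comm, ← pow_add, ← smul_eq_C_mul, map_smul, hP, smul_eq_C_mul, C_mul,
      mul_assoc]
  have hleft : P (P (X ^ m) * X ^ n) = C (β m * β (θ m + n)) * X ^ θ (θ m + n) := by
    rw [hP m, mul_assoc, ← pow_add, ← smul_eq_C_mul, map_smul, hP, smul_eq_C_mul, C_mul,
      mul_assoc]
  have hweight : lam • P (X ^ m * X ^ n) = C (lam * β (m + n)) * X ^ θ (m + n) := by
    rw [← pow_add, hP, smul_eq_C_mul, C_mul, mul_assoc]
  have h := congrArg (fun p => coeff p d) (hRB (X ^ m) (X ^ n))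
  simpa only [hmul, hright, hleft, hweight, coeff_add, coeff_C_mul_X_pow] using h

/-- Lemma 3.3(2): for a nonzero monomial Rota-Baxter operator of nonzero weight
with `S_θ = ℕ*`, if `θ m = θ n` for positive `m, n` then `θ (m + n) = 2·θ m`. -/
theorem monomial_rota_baxter_nonzero_weight_theta_eq_add
    {R : Type*} [CommRing R] [IsDomain R] [Algebra ℚ R]
    (lam : R) (hlam : lam ≠ 0)
    (β : ℕ → R) (θ : ℕ → ℕ) (hconv : ∀ n, β n = 0 → θ n = 0)
    (P : Polynomial R →ₗ[R] Polynomial R)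
    (hP : ∀ n : ℕ, P (X ^ n) = C (β n) * X ^ (θ n))
    (hRB : ∀ f g : Polynomial R,
      P f * P g = P (f * P g) + P (P f * g) + lam • P (f * g))
    (hnz : ∃ n : ℕ, β n ≠ 0)
    (hSθ : ∀ n : ℕ, θ n ≠ 0 ↔ n ≠ 0) :
    ∀ m n : ℕ, 0 < m → 0 < n → θ m = θ n → θ (m + n) = 2 * θ m := by
  have hβ : ∀ n, n ≠ 0 → β n ≠ 0 := fun n hn h => (hSθ n).2 hn (hconv n h)
  have hcoeff := monomial_rota_baxter_coeff lam β θ P hP hRB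
  have : CharZero R := algebraRat.charZero R
  have hdiag : ∀ m, 0 < m → θ (m + θ m) = 2 * θ m := by
    intro m hm
    by_contra hne
    have htop := hcoeff m m (2 * θ m)
    have hoff := hcoeff m m (θ (m + θ m))
    rw [add_comm (θ m) m, ← two_mul (θ m)] at htop hoff
    have hβm := hβ m hm.ne'
    have hβs := hβ (m + θ m) (by omega)
    by_cases hC : 2 * θ m = θ (m + m)
    · rw [← hC] at hoff
      simp only [hne, if_true, if_false, add_zero, ← two_mul] at hoff
      exact mul_ne_zero two_ne_zero (mul_ne_zero hβm hβs) hoff.symm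
    · simp only [Ne.symm hne, hC, if_true, if_false, add_zero] at htop
      exact mul_ne_zero hβm hβm htop
  intro m n hm hn hmn
  by_contra hne
  have h := hcoeff m n (θ (m + n))
  have hA : θ (m + θ n) = 2 * θ m := hmn ▸ hdiag m hm
  have hB : θ (θ m + n) = 2 * θ m := by rw [hmn, add_comm, hdiag n hn]
  rw [hA, hB, ← hmn, ← two_mul (θ m)] at h
  simp only [hne, if_true, if_false, zero_add] at h
  exact mul_ne_zero hlam (hβ (m + n) (by omega)) h.symm
end
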